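/- arXiv:0906.3749 — 2 statements merged into one kernel-verified Lean document; each statement's English description precedes it below -/
import Mathlib

section
/- For the 6-state 2-symbol Turing machine M with transition table δ(A,0)=(1,R,B), δ(A,1)=(0,L,D), δ(B,0)=(1,R,C), δ(B,1)=(0,R,F), δ(C,0)=(1,L,C), δ(C,1)=(1,L,A), δ(D,0)=(0,L,E), δ(D,1)=(1,R,H), δ(E,0)=(1,L,A), δ(E,1)=(0,R,B), δ(F,0)=(0,R,C), δ(F,1)=(0,R,E): started in state A on the all-blank tape the machine reaches a configuration C(5,2) in exactly 47 steps; and for all natural numbers n and k: from C(0,k) it halts in exactly 3 steps, the final tape reading left to right (all other cells blank): 1, the halted head scanning a cell containing 0, then 3k+1 cells containing 1; from C(1,k) it reaches C(3k+2,2) in exactly 3k+37 steps; from C(2,k) it reaches C(4,k+2) in exactly 12k+44 steps; from C(3,k) it reaches C(3k+8,2) in exactly 3k+57 steps; and from C(n+4,k) it reaches C(n,3k+5) in exactly 27k²+105k+112 steps. -/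
/-- Move direction of the tape head. -/
inductive Dir : Type
  | L
  | R

/-- The head displacement of a direction. -/
def Dir.move : Dir → ℤ
  | Dir.L => -1
  | Dir.R => 1

/-- A Turing machine with `n` states and `k` symbols, in Rado's busy beaver model.
States are `Fin n` (state `A` is `0`, `B` is `1`, ...), symbols are `Fin k` with `0`
the blank symbol. A transition yields the written symbol, the move direction and the
next state, where `none` denotes the halting state `H`. -/
abbrev Machine (n k : ℕ) : Type :=
  Fin n → Fin k → Fin k × Dir × Option (Fin n)

/-- A configuration: current state (`none` = halted), head position, tape. -/
structure Cfg (n k : ℕ) where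
  state : Option (Fin n)
  pos : ℤ
  tape : ℤ → Fin k

/-- One computation step (halted configurations are fixed). -/
def step {n k : ℕ} (M : Machine n k) (c : Cfg n k) : Cfg n k :=
  match c.state with
  | none => c
  | some q =>
      { state := (M q (c.tape c.pos)).2.2
        pos := c.pos + (M q (c.tape c.pos)).2.1.move
        tape := Function.update c.tape c.pos (M q (c.tape c.pos)).1 }

/-- The initial configuration: state `A`, head at cell `0`, all-blank tape. -/
def init (n k : ℕ) [NeZero k] : Cfg n k :=
  { state := if h : 0 < n then some ⟨0, h⟩ else none
    pos := 0
    tape := fun _ => 0 }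

/-- `HaltsIn M c t`: started from `c`, the machine `M` halts after exactly `t` steps. -/
def HaltsIn {n k : ℕ} (M : Machine n k) (c : Cfg n k) (t : ℕ) : Prop :=
  ((step M)^[t] c).state = none ∧ ∀ i < t, ((step M)^[i] c).state ≠ none

/-- The number of non-blank cells of a configuration. -/
noncomputable def sigmaCount {n k : ℕ} [NeZero k] (c : Cfg n k) : ℕ :=
  Set.ncard {i : ℤ | c.tape i ≠ 0}

/-- Kropitz's 6-state 2-symbol machine
(states `A,B,C,D,E,F` are `0,1,2,3,4,5`; `none` is the halting state `H`). -/
def M : Machine 6 2 :=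
  ![![(1, Dir.R, some 1), (0, Dir.L, some 3)],
    ![(1, Dir.R, some 2), (0, Dir.R, some 5)],
    ![(1, Dir.L, some 2), (1, Dir.L, some 0)],
    ![(0, Dir.L, some 4), (1, Dir.R, none)],
    ![(1, Dir.L, some 0), (0, Dir.R, some 1)],
    ![(0, Dir.R, some 2), (0, Dir.R, some 4)]]

/-- The configuration `C(n,k)` based at cell `p`: the tape reads (all other cells blank)
one cell `1` at `p`, then `n` blank cells, then `3k+2` cells `1` (a separator `1`
followed by `3k+1` cells `1`), the machine being in state `C` scanning the leftmost of
these `3k+1` cells, i.e. cell `p+n+2`. -/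
def Cf (n k : ℕ) (p : ℤ) : Cfg 6 2 :=
  { state := some 2
    pos := p + n + 2
    tape := fun i => if i = p ∨ (p + n + 1 ≤ i ∧ i ≤ p + n + 2 + 3 * k) then 1 else 0 }

open Function List

/-- A configuration up to translation: the state, the cells to the left of the head (nearest
first), and the cells from the head rightwards. Cells beyond the ends of the lists are blank. -/
abbrev ListCfg (n k : ℕ) : Type :=
  Option (Fin n) × List (Fin k) × List (Fin k)

/-- The configuration described by a `ListCfg` with the head at position `p`. -/
def ListCfg.toCfg {n k : ℕ} [NeZero k] (a : ListCfg n k) (p : ℤ) : Cfg n k :=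
  { state := a.1
    pos := p
    tape := fun i =>
      if i < p then a.2.1.getD (p - 1 - i).toNat 0 else a.2.2.getD (i - p).toNat 0 }

/-- One computation step on `ListCfg`s. -/
def listStep {n k : ℕ} [NeZero k] (N : Machine n k) : ListCfg n k → ListCfg n k
  | (none, l, r) => (none, l, r)
  | (some q, l, r) =>
    match N q (r.headD 0) with
    | (w, Dir.R, s) => (s, w :: l, r.tail)
    | (w, Dir.L, s) => (s, l.tail, l.headD 0 :: w :: r.tail)

theorem List.getD_eq_headD_or_tail {α : Type*} (l : List α) (d : α) (m : ℕ) :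
    l.getD m d = if m = 0 then l.headD d else l.tail.getD (m - 1) d := by
  cases l <;> cases m <;> simp

theorem List.getD_cons_eq_ite {α : Type*} (x : α) (l : List α) (d : α) (m : ℕ) :
    (x :: l).getD m d = if m = 0 then x else l.getD (m - 1) d := by
  cases m <;> simp

theorem exists_step_toCfg {n k : ℕ} [NeZero k] (N : Machine n k) (a : ListCfg n k) (p : ℤ) :
    ∃ p', step N (a.toCfg p) = (listStep N a).toCfg p' := by
  obtain ⟨_ | q, l, r⟩ := a
  · exact ⟨p, rfl⟩
  have hd : r.getD 0 0 = r.headD 0 := by cases r <;> rfl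
  rcases hN : N q (r.headD 0) with ⟨w, _ | _, s⟩
  · refine ⟨p - 1, ?_⟩
    simp only [step, listStep, ListCfg.toCfg, lt_irrefl, if_false, sub_self, Int.toNat_zero, hd,
      hN, Dir.move, Cfg.mk.injEq, true_and]
    refine ⟨by ring, funext fun i => ?_⟩
    rw [Function.update_apply, List.getD_cons_eq_ite, List.getD_cons_eq_ite,
      List.getD_eq_headD_or_tail l, List.getD_eq_headD_or_tail r]
    have e₁ : (p - 1 - i).toNat - 1 = (p - 1 - 1 - i).toNat := by omega
    have e₂ : (i - (p - 1)).toNat - 1 - 1 = (i - p).toNat - 1 := by omega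
    rw [e₁, e₂]
    split_ifs <;> first | rfl | omega
  · refine ⟨p + 1, ?_⟩
    simp only [step, listStep, ListCfg.toCfg, lt_irrefl, if_false, sub_self, Int.toNat_zero, hd,
      hN, Dir.move, Cfg.mk.injEq, true_and]
    refine funext fun i => ?_
    rw [Function.update_apply, List.getD_cons_eq_ite, List.getD_eq_headD_or_tail r]
    have e₁ : (p + 1 - 1 - i).toNat - 1 = (p - 1 - i).toNat := by omega
    have e₂ : (i - p).toNat - 1 = (i - (p + 1)).toNat := by omega
    rw [e₁, e₂]
    split_ifs <;> first | rfl | omega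

theorem exists_iterate_step_toCfg {n k : ℕ} [NeZero k] (N : Machine n k) (t : ℕ)
    (a : ListCfg n k) (p : ℤ) :
    ∃ p', (step N)^[t] (a.toCfg p) = ((listStep N)^[t] a).toCfg p' := by
  induction t generalizing a p with
  | zero => exact ⟨p, rfl⟩
  | succ t ih =>
    obtain ⟨p', h⟩ := exists_step_toCfg N a p
    rw [iterate_succ_apply, iterate_succ_apply, h]
    exact ih _ _

theorem Function.iterate_add_eq {α : Type*} {f : α → α} {s t : ℕ} {a b c : α}
    (hab : f^[s] a = b) (hbc : f^[t] b = c) : f^[s + t] a = c := by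
  rw [Nat.add_comm, iterate_add_apply, hab, hbc]

theorem List.replicate_append_cons {α : Type*} (m : ℕ) (x : α) (l : List α) :
    replicate m x ++ x :: l = x :: (replicate m x ++ l) := by
  induction m with
  | zero => rfl
  | succ m ih => simp [replicate_succ, ih]

/-- State `B` sweeps right over blocks of three `1`s, erasing them. -/
theorem sweep_right (m : ℕ) (l r : List (Fin 2)) :
    (listStep M)^[3 * m] (some 1, l, replicate (3 * m) 1 ++ r) =
      (some 1, replicate (3 * m) 0 ++ l, r) := by
  induction m generalizing l with
  | zero => rfl
  | succ m ih =>
    rw [show 3 * (m + 1) = 3 + 3 * m by ring]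
    refine iterate_add_eq (b := (some 1, 0 :: 0 :: 0 :: l, replicate (3 * m) 1 ++ r)) ?_ ?_
    · rw [replicate_add]; rfl
    · rw [ih, Nat.add_comm 3, replicate_add, append_assoc]; rfl

/-- State `C` sweeps left over `0`s, turning them into `1`s. -/
theorem sweep_left (m : ℕ) (l r : List (Fin 2)) :
    (listStep M)^[m] (some 2, replicate m 0 ++ l, 0 :: r) =
      (some 2, l, 0 :: (replicate m 1 ++ r)) := by
  induction m generalizing r with
  | zero => rfl
  | succ m ih =>
    rw [Nat.add_comm]
    refine iterate_add_eq (b := (some 2, replicate m 0 ++ l, 0 :: 1 :: r)) ?_ ?_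
    · rw [Nat.add_comm]; rfl
    · rw [ih, replicate_append_cons, Nat.add_comm, replicate_succ]; rfl

/-- A `0` to the left of the block of `1`s is absorbed, the block growing by three. -/
theorem absorb_zero (b : ℕ) (l : List (Fin 2)) :
    (listStep M)^[6 * b + 7] (some 2, 0 :: l, replicate (3 * b + 1) 1) =
      (some 2, l, replicate (3 * (b + 1) + 1) 1) := by
  rw [show 6 * b + 7 = 2 + (3 * b + (3 + ((3 * b + 1) + 1))) by ring]
  refine iterate_add_eq (b := (some 1, 1 :: l, replicate (3 * b) 1 ++ [1])) ?_
    (iterate_add_eq (sweep_right b (1 :: l) [1])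
    (iterate_add_eq (b := (some 2, replicate (3 * b + 1) 0 ++ 1 :: l, [0, 1])) ?_
    (iterate_add_eq (b := (some 2, 1 :: l, 0 :: (replicate (3 * b + 1) 1 ++ [1]))) ?_ ?_)))
  · rw [replicate_append_cons, append_nil]; rfl
  · rfl
  · exact sweep_left _ _ _
  · rw [replicate_append_cons, append_nil]; rfl

theorem absorb_zeros (c b : ℕ) (l : List (Fin 2)) :
    (listStep M)^[6 * b * c + 3 * c ^ 2 + 4 * c]
        (some 2, replicate c 0 ++ l, replicate (3 * b + 1) 1) =
      (some 2, l, replicate (3 * (b + c) + 1) 1) := by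
  induction c generalizing b with
  | zero => rfl
  | succ c ih =>
    rw [show 6 * b * (c + 1) + 3 * (c + 1) ^ 2 + 4 * (c + 1) =
      (6 * b + 7) + (6 * (b + 1) * c + 3 * c ^ 2 + 4 * c) by ring]
    rw [replicate_succ, cons_append]
    refine iterate_add_eq (absorb_zero b (replicate c 0 ++ l)) ?_
    rw [ih, show b + 1 + c = b + (c + 1) by ring]

/-- The `ListCfg` of the configuration `Cf n k p`. -/
def listCf (n k : ℕ) : ListCfg 6 2 :=
  (some 2, 1 :: (replicate n 0 ++ [1]), replicate (3 * k + 1) 1)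

theorem List.getD_replicate_append {α : Type*} (m : ℕ) (x d : α) (l : List α) (j : ℕ) :
    (replicate m x ++ l).getD j d = if j < m then x else l.getD (j - m) d := by
  split_ifs with h
  · rw [getD_append _ _ _ _ (by simpa using h), getD_replicate _ h]
  · rw [getD_append_right _ _ _ _ (by simpa using h), length_replicate]

theorem List.getD_replicate_eq_ite {α : Type*} (m : ℕ) (x d : α) (j : ℕ) :
    (replicate m x).getD j d = if j < m then x else d := by
  simpa using getD_replicate_append m x d [] j

theorem toCfg_listCf (n k : ℕ) (p : ℤ) : (listCf n k).toCfg (p + n + 2) = Cf n k p := by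
  simp only [ListCfg.toCfg, listCf, Cf, Cfg.mk.injEq, true_and]
  funext i
  rw [getD_cons_eq_ite, getD_replicate_append, getD_cons_eq_ite, getD_replicate_eq_ite, getD_nil]
  split_ifs <;> first | rfl | omega

theorem exists_iterate_step_eq_Cf {t : ℕ} {a : ListCfg 6 2} {n k : ℕ}
    (h : (listStep M)^[t] a = listCf n k) (p : ℤ) :
    ∃ q, (step M)^[t] (a.toCfg p) = Cf n k q := by
  obtain ⟨p', hp'⟩ := exists_iterate_step_toCfg M t a p
  exact ⟨p' - n - 2, by rw [hp', h, ← toCfg_listCf]; congr 1; ring⟩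

theorem listCf_zero_halts (k : ℕ) :
    (listStep M)^[3] (listCf 0 k) = (none, [1], 0 :: replicate (3 * k + 1) 1) := rfl

/-- From the right end of an erased tape, `C(·, 2)` is rebuilt in 26 steps. -/
theorem rebuild (l : List (Fin 2)) :
    (listStep M)^[26] (some 1, 0 :: l, []) = (some 2, 1 :: l, replicate 7 1) := rfl

theorem sweep_right_rebuild (m : ℕ) :
    (listStep M)^[3 * (m + 1) + 26] (some 1, [1], replicate (3 * (m + 1)) 1) =
      listCf (3 * m + 2) 2 := by
  have h := sweep_right (m + 1) [1] []
  have hzeros : replicate (3 * (m + 1)) (0 : Fin 2) ++ [1] =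
      0 :: (replicate (3 * m + 2) 0 ++ [1]) := rfl
  rw [append_nil, hzeros] at h
  exact iterate_add_eq h (rebuild (replicate (3 * m + 2) 0 ++ [1]))

theorem listCf_one (k : ℕ) :
    (listStep M)^[3 * k + 37] (listCf 1 k) = listCf (3 * k + 2) 2 := by
  rw [show 3 * k + 37 = 8 + (3 * (k + 1) + 26) by ring]
  exact iterate_add_eq rfl (sweep_right_rebuild k)

theorem listCf_two (k : ℕ) :
    (listStep M)^[12 * k + 44] (listCf 2 k) = listCf 4 (k + 2) := by
  rw [show 12 * k + 44 = 24 + (6 * k * 2 + 3 * 2 ^ 2 + 4 * 2) by ring]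
  exact iterate_add_eq rfl (absorb_zeros 2 k [1, 0, 0, 0, 0, 1])

theorem listCf_three (k : ℕ) :
    (listStep M)^[3 * k + 57] (listCf 3 k) = listCf (3 * k + 8) 2 := by
  rw [show 3 * k + 57 = 22 + (3 * ((k + 2) + 1) + 26) by ring]
  exact iterate_add_eq rfl (sweep_right_rebuild (k + 2))

theorem listCf_add_four (n k : ℕ) :
    (listStep M)^[27 * k ^ 2 + 105 * k + 112] (listCf (n + 4) k) = listCf n (3 * k + 5) := by
  have hsum : 27 * k ^ 2 + 105 * k + 112 = 12 + (3 * (k + 1) + (9 +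
      (6 * 1 * (3 * (k + 1) + 1) + 3 * (3 * (k + 1) + 1) ^ 2 + 4 * (3 * (k + 1) + 1)))) := by
    ring
  rw [hsum]
  refine iterate_add_eq
    (b := (some 1, 1 :: (replicate n 0 ++ [1]), replicate (3 * (k + 1)) 1 ++ [1, 1])) ?_
    (iterate_add_eq (sweep_right _ _ _)
    (iterate_add_eq (b := (some 2,
      replicate (3 * (k + 1) + 1) 0 ++ 1 :: (replicate n 0 ++ [1]), replicate (3 * 1 + 1) 1))
      rfl ?_))
  · rw [replicate_append_cons, replicate_append_cons, append_nil]; rfl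
  · rw [absorb_zeros, show 1 + (3 * (k + 1) + 1) = 3 * k + 5 by ring]; rfl

theorem toCfg_blank : ListCfg.toCfg (some 0, [], []) 0 = init 6 2 := by
  simp [ListCfg.toCfg, init]

/-- Ligocki's analysis of Kropitz's machine: the blank tape leads to `C(5,2)` in 47 steps;
`C(0,k)` halts in 3 steps with final tape `…0 1 (H0) 1^{3k+1} 0…`;
`C(1,k) ⊢(3k+37) C(3k+2,2)`; `C(2,k) ⊢(12k+44) C(4,k+2)`; `C(3,k) ⊢(3k+57) C(3k+8,2)`;
and `C(n+4,k) ⊢(27k²+105k+112) C(n,3k+5)`. -/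
theorem kropitz_analysis :
    (∃ q : ℤ, (step M)^[47] (init 6 2) = Cf 5 2 q) ∧
    ∀ n k : ℕ, ∀ p : ℤ,
      (HaltsIn M (Cf 0 k p) 3 ∧
        ∃ q : ℤ, (step M)^[3] (Cf 0 k p) =
          { state := none
            pos := q + 1
            tape := fun i => if i = q ∨ (q + 2 ≤ i ∧ i ≤ q + 2 + 3 * k) then 1 else 0 }) ∧
      (∃ q : ℤ, (step M)^[3 * k + 37] (Cf 1 k p) = Cf (3 * k + 2) 2 q) ∧
      (∃ q : ℤ, (step M)^[12 * k + 44] (Cf 2 k p) = Cf 4 (k + 2) q) ∧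
      (∃ q : ℤ, (step M)^[3 * k + 57] (Cf 3 k p) = Cf (3 * k + 8) 2 q) ∧
      (∃ q : ℤ, (step M)^[27 * k ^ 2 + 105 * k + 112] (Cf (n + 4) k p) =
        Cf n (3 * k + 5) q) := by
  refine ⟨?_, fun n k p => ⟨⟨⟨?_, fun i hi => ?_⟩, ?_⟩, ?_, ?_, ?_, ?_⟩⟩
  · rw [← toCfg_blank]
    exact exists_iterate_step_eq_Cf rfl 0
  · obtain ⟨p', h⟩ := exists_iterate_step_toCfg M 3 (listCf 0 k) (p + (0 : ℕ) + 2)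
    rw [← toCfg_listCf, h, listCf_zero_halts]
    rfl
  · obtain ⟨p', h⟩ := exists_iterate_step_toCfg M i (listCf 0 k) (p + (0 : ℕ) + 2)
    rw [← toCfg_listCf, h]
    interval_cases i <;> exact Option.some_ne_none _
  · obtain ⟨p', h⟩ := exists_iterate_step_toCfg M 3 (listCf 0 k) (p + (0 : ℕ) + 2)
    refine ⟨p' - 1, ?_⟩
    rw [← toCfg_listCf, h, listCf_zero_halts]
    simp only [ListCfg.toCfg, Cfg.mk.injEq, true_and]
    refine ⟨by ring, funext fun i => ?_⟩
    rw [List.getD_cons_eq_ite, List.getD_cons_eq_ite, List.getD_replicate_eq_ite, getD_nil]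
    split_ifs <;> first | rfl | omega
  all_goals rw [← toCfg_listCf]
  · exact exists_iterate_step_eq_Cf (listCf_one k) _
  · exact exists_iterate_step_eq_Cf (listCf_two k) _
  · exact exists_iterate_step_eq_Cf (listCf_three k) _
  · exact exists_iterate_step_eq_Cf (listCf_add_four n k) _
end

section
/- For the 6-state 2-symbol Turing machine M with transition table δ(A,0)=(1,R,B), δ(A,1)=(0,L,D), δ(B,0)=(1,R,C), δ(B,1)=(0,R,F), δ(C,0)=(1,L,C), δ(C,1)=(1,L,A), δ(D,0)=(0,L,E), δ(D,1)=(1,R,H), δ(E,0)=(1,L,A), δ(E,1)=(0,R,B), δ(F,0)=(0,R,C), δ(F,1)=(0,R,E), and for all natural numbers n and r: from any configuration C(4n+r, 2) the machine reaches a configuration C(r, (3^(n+2) − 5)/2) in exactly (3·9^(n+3) − 80·3^(n+3) + 584n − 27)/32 steps. -/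
open Classical in
/-- The configuration in state `q` at cell `x` whose cells containing `1` are those in `S`. -/
noncomputable def conf (q : Fin 6) (x : ℤ) (S : ℤ → Prop) : Cfg 6 2 :=
  { state := some q, pos := x, tape := fun i => if S i then 1 else 0 }

/-- `M` leads from `c` to `d` in exactly `t` steps. -/
def Reach (t : ℕ) (c d : Cfg 6 2) : Prop := (step M)^[t] c = d

lemma conf_congr {q : Fin 6} {x y : ℤ} {S T : ℤ → Prop} (hxy : x = y) (h : ∀ i, S i ↔ T i) :
    conf q x S = conf q y T := by
  obtain rfl : S = T := funext fun i => propext (h i)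
  rw [hxy]

lemma Cf_eq_conf (n k : ℕ) (p : ℤ) :
    Cf n k p = conf 2 (p + n + 2)
      (fun i => i = p ∨ (p + n + 1 ≤ i ∧ i ≤ p + n + 2 + 3 * k)) := by
  unfold Cf conf
  congr 1
  funext i
  split_ifs <;> rfl

lemma Reach.refl {c d : Cfg 6 2} (h : c = d) : Reach 0 c d := h

lemma Reach.trans {s t : ℕ} {c d e : Cfg 6 2} (h₁ : Reach s c d) (h₂ : Reach t d e) :
    Reach (s + t) c e := by
  unfold Reach at *
  rw [Nat.add_comm, Function.iterate_add_apply, h₁, h₂]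

lemma Reach.of_eq {s t : ℕ} {c d : Cfg 6 2} (h : Reach s c d) (hst : s = t) : Reach t c d :=
  hst ▸ h

lemma Reach.target {t : ℕ} {c d e : Cfg 6 2} (h : Reach t c d) (hd : d = e) : Reach t c e :=
  hd ▸ h

lemma Reach.head {t : ℕ} {c d e : Cfg 6 2} (h : step M c = d) (hr : Reach t d e) :
    Reach (t + 1) c e := by
  unfold Reach
  rw [Function.iterate_succ_apply, h]
  exact hr

section Steps

variable {q : Fin 6} {x : ℤ} {S : ℤ → Prop} {t : ℕ} {e : Cfg 6 2}

/-- A step reading and writing `1`. -/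
lemma Reach.keep_one (d : Dir) (q' : Fin 6) (hM : M q 1 = (1, d, some q')) (h : S x)
    (hr : Reach t (conf q' (x + d.move) S) e) : Reach (t + 1) (conf q x S) e := by
  refine Reach.head ?_ hr
  simp only [step, conf, if_pos h, hM]
  congr 1
  funext i
  by_cases hi : i = x <;> simp [hi, h]

/-- A step reading and writing `0`. -/
lemma Reach.keep_zero (d : Dir) (q' : Fin 6) (hM : M q 0 = (0, d, some q')) (h : ¬ S x)
    (hr : Reach t (conf q' (x + d.move) S) e) : Reach (t + 1) (conf q x S) e := by
  refine Reach.head ?_ hr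
  simp only [step, conf, if_neg h, hM]
  congr 1
  funext i
  by_cases hi : i = x <;> simp [hi, h]

/-- A step replacing `0` by `1`. -/
lemma Reach.mark (d : Dir) (q' : Fin 6) (hM : M q 0 = (1, d, some q')) (h : ¬ S x)
    (hr : Reach t (conf q' (x + d.move) (fun i => i = x ∨ S i)) e) :
    Reach (t + 1) (conf q x S) e := by
  refine Reach.head ?_ hr
  simp only [step, conf, if_neg h, hM]
  congr 1
  funext i
  by_cases hi : i = x <;> by_cases hS : S i <;> simp [hi, hS]

/-- A step replacing `1` by `0`. -/
lemma Reach.erase (d : Dir) (q' : Fin 6) (hM : M q 1 = (0, d, some q')) (h : S x)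
    (hr : Reach t (conf q' (x + d.move) (fun i => i ≠ x ∧ S i)) e) :
    Reach (t + 1) (conf q x S) e := by
  refine Reach.head ?_ hr
  simp only [step, conf, if_pos h, hM]
  congr 1
  funext i
  by_cases hi : i = x <;> by_cases hS : S i <;> simp [hi, hS]

end Steps

lemma Dir.move_L : Dir.L.move = -1 := rfl

lemma Dir.move_R : Dir.R.move = 1 := rfl

/-- States `B`, `F`, `E` erase a block of `3a` ones while moving right. -/
lemma sweep_right_s9 (a : ℕ) (x : ℤ) (S : ℤ → Prop) (h : ∀ i, x ≤ i → i < x + 3 * a → S i) :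
    Reach (3 * a) (conf 1 x S)
      (conf 1 (x + 3 * a) (fun i => ¬ (x ≤ i ∧ i < x + 3 * a) ∧ S i)) := by
  have := Dir.move_R
  induction a generalizing x S with
  | zero => exact Reach.refl (conf_congr (by simp) fun i => by simp)
  | succ a ih =>
    push_cast at h ⊢
    refine Reach.erase Dir.R 5 rfl (h _ (by omega) (by omega)) ?_
    refine Reach.erase Dir.R 4 rfl ⟨by omega, h _ (by omega) (by omega)⟩ ?_
    refine Reach.erase Dir.R 1 rfl ⟨by omega, by omega, h _ (by omega) (by omega)⟩ ?_
    refine (ih _ _ ?_).target ?_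
    rotate_left
    · refine conf_congr (by omega) fun i => ?_
      by_cases hi : S i
      · simp only [hi, and_true]; omega
      · simp only [hi, and_false]
    · intro i h₁ h₂
      exact ⟨by omega, by omega, by omega, h _ (by omega) (by omega)⟩

/-- State `C` fills a block of `l` zeros with ones while moving left. -/
lemma sweep_left_s9 (l : ℕ) (x : ℤ) (S : ℤ → Prop) (h : ∀ i, x - l < i → i ≤ x → ¬ S i) :
    Reach l (conf 2 x S) (conf 2 (x - l) (fun i => (x - l < i ∧ i ≤ x) ∨ S i)) := by
  have := Dir.move_L
  induction l generalizing x S with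
  | zero => exact Reach.refl (conf_congr (by simp) fun i => by simp)
  | succ l ih =>
    push_cast at h ⊢
    refine Reach.mark Dir.L 2 rfl (h _ (by omega) (by omega)) ?_
    refine (ih _ _ ?_).target ?_
    rotate_left
    · refine conf_congr (by omega) fun i => ?_
      by_cases hi : S i
      · simp only [hi, or_true]
      · simp only [hi, or_false]; omega
    · rintro i h₁ h₂ (h₃ | h₃)
      · omega
      · exact h _ (by omega) (by omega) h₃

/-- A right sweep over `3a+1` ones from cell `x` followed by the left sweep back to `x-1`. -/
lemma sweep_round (a : ℕ) (p c x : ℤ) (hpc : p < c) (hcx : c + 2 ≤ x) :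
    Reach (6 * a + 5)
      (conf 1 x (fun i => i = p ∨ i = c ∨ (x - 1 ≤ i ∧ i ≤ x + 3 * a)))
      (conf 2 (x - 1) (fun i => i = p ∨ i = c ∨ (x - 1 ≤ i ∧ i ≤ x + 3 * a + 2))) := by
  have := Dir.move_R
  refine Reach.of_eq ((sweep_right_s9 a x _ ?_).trans (t := 3 * a + 5) ?_) (by omega)
  · intro i _ _; omega
  refine Reach.erase Dir.R 5 rfl (by omega) ?_
  refine Reach.keep_zero Dir.R 2 rfl (by omega) ?_
  convert sweep_left_s9 (3 * a + 3) _ _ ?_ using 1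
  · exact conf_congr (by push_cast; omega) fun i => by push_cast; omega
  · push_cast; intro i _ _; omega

/-- Iterated rounds, until the block of ones reaches the cell `c` containing `1`. -/
lemma sweep_rounds (N a : ℕ) (p c : ℤ) (hpc : p < c) :
    Reach (N * (6 * a + 7 + 3 * (N + 1)) + 6 * a + 5)
      (conf 1 (c + 2 + N)
        (fun i => i = p ∨ i = c ∨ (c + 1 + N ≤ i ∧ i ≤ c + 2 + N + 3 * a)))
      (conf 2 (c + 1) (fun i => i = p ∨ (c ≤ i ∧ i ≤ c + 3 * (a + N) + 4))) := by
  have := Dir.move_R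
  have := Dir.move_L
  induction N generalizing a with
  | zero =>
    have h := sweep_round a p c (c + 2) hpc le_rfl
    convert h using 1
    · simp
    · exact conf_congr (by simp) fun i => by push_cast; omega
    · exact conf_congr (by omega) fun i => by push_cast; omega
  | succ N ih =>
    have h := sweep_round a p c (c + 2 + (N + 1 : ℕ)) hpc (by omega)
    have ih := ih (a + 1)
    push_cast at h ih ⊢
    refine Reach.of_eq (Reach.trans (d := conf 2 (c + 2 + N) (fun i => i = p ∨ i = c ∨
      (c + 2 + N ≤ i ∧ i ≤ c + 2 + (N + 1) + 3 * a + 2))) ?_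
      (Reach.keep_one Dir.L 0 rfl (by omega) (Reach.mark Dir.R 1 rfl (by omega) ?_)))
      (s := (6 * a + 5) +
        ((N * (6 * (a + 1) + 7 + 3 * (N + 1)) + 6 * (a + 1) + 5) + 1 + 1)) (by ring)
    · convert h using 1
      · exact conf_congr (by omega) fun i => by omega
      · exact conf_congr (by omega) fun i => by omega
    · convert ih using 1
      · exact conf_congr (by omega) fun i => by omega
      · exact conf_congr (by omega) fun i => by omega

/-- The first twelve steps from `C(n+4,k)`. -/
lemma Cf_prefix (n k : ℕ) (p : ℤ) :
    Reach 12 (Cf (n + 4) k p)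
      (conf 1 (p + n + 2)
        (fun i => i = p ∨ i = p + n + 1 ∨ (p + n + 1 ≤ i ∧ i ≤ p + n + 6 + 3 * k))) := by
  have := Dir.move_R
  have := Dir.move_L
  rw [Cf_eq_conf]
  push_cast
  refine Reach.keep_one Dir.L 0 rfl (by omega) ?_
  refine Reach.erase Dir.L 3 rfl (by omega) ?_
  refine Reach.keep_zero Dir.L 4 rfl (by omega) ?_
  refine Reach.mark Dir.L 0 rfl (by omega) ?_
  refine Reach.mark Dir.R 1 rfl (by omega) ?_
  refine Reach.erase Dir.R 5 rfl (by omega) ?_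
  refine Reach.keep_zero Dir.R 2 rfl (by omega) ?_
  refine Reach.mark Dir.L 2 rfl (by omega) ?_
  refine Reach.mark Dir.L 2 rfl (by omega) ?_
  refine Reach.mark Dir.L 2 rfl (by omega) ?_
  refine Reach.keep_one Dir.L 0 rfl (by omega) ?_
  refine Reach.mark Dir.R 1 rfl (by omega) ?_
  exact Reach.refl (conf_congr (by omega) fun i => by omega)

/-- `C(n+4,k)` leads to `C(n,3k+5)`. -/
lemma Cf_add_four (n k : ℕ) (p : ℤ) :
    Reach (27 * k ^ 2 + 105 * k + 112) (Cf (n + 4) k p) (Cf n (3 * k + 5) p) := by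
  have := Dir.move_R
  have := Dir.move_L
  refine Reach.of_eq ((Cf_prefix n k p).trans ((sweep_right_s9 (k + 1) _ _ ?_).trans
    (Reach.erase Dir.R 5 rfl ?_ (Reach.erase Dir.R 4 rfl ?_
    (Reach.mark Dir.L 0 rfl ?_ (Reach.mark Dir.R 1 rfl ?_ ?_))))))
    (s := 12 + (3 * (k + 1) + (((3 * k + 4) * (6 * 0 + 7 + 3 * ((3 * k + 4) + 1)) + 6 * 0 + 5)
      + 1 + 1 + 1 + 1))) (by ring)
  · push_cast; intro i _ _; omega
  · push_cast; omega
  · push_cast; omega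
  · push_cast; omega
  · push_cast; omega
  · rw [Cf_eq_conf]
    convert sweep_rounds (3 * k + 4) 0 p (p + n + 1) (by omega) using 1
    · exact conf_congr (by push_cast; omega) fun i => by push_cast; omega
    · exact conf_congr (by omega) fun i => by omega

lemma Cf_iterate (n r : ℕ) (p : ℤ) :
    ∃ t k : ℕ, 32 * (t : ℤ) = 3 * 9 ^ (n + 3) - 80 * 3 ^ (n + 3) + 584 * n - 27 ∧
      2 * k + 5 = 3 ^ (n + 2) ∧ Reach t (Cf (4 * n + r) 2 p) (Cf r k p) := by
  induction n generalizing r with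
  | zero => exact ⟨0, 2, by norm_num, by norm_num, Reach.refl (by simp)⟩
  | succ n ih =>
    obtain ⟨t, k, ht, hk, h⟩ := ih (r + 4)
    refine ⟨t + (27 * k ^ 2 + 105 * k + 112), 3 * k + 5, ?_, ?_, ?_⟩
    · have hu : (3 : ℤ) ^ n * 9 = 2 * k + 5 := by
        have : (2 * k + 5 : ℤ) = 3 ^ (n + 2) := by exact_mod_cast hk
        rw [this]; ring
      have h9 : (9 : ℤ) ^ n = (3 ^ n) ^ 2 := by
        rw [← pow_mul, mul_comm, pow_mul]; norm_num
      simp only [pow_add, h9] at ht ⊢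
      push_cast
      linear_combination ht - (216 * (3 ^ n * 9 + 2 * (k : ℤ) + 5) - 480) * hu
    · rw [pow_succ, pow_succ] at *
      omega
    · rw [show 4 * (n + 1) + r = 4 * n + (r + 4) by ring]
      exact h.trans (Cf_add_four r k p)

/-- For all `n, r`: `C(4n+r, 2)` leads to `C(r, (3^(n+2)-5)/2)` in exactly
`(3·9^(n+3) - 80·3^(n+3) + 584n - 27)/32` steps. -/
theorem kropitz_iteration (n r : ℕ) (p : ℤ) :
    ∃ t : ℕ, (t : ℤ) = (3 * 9 ^ (n + 3) - 80 * 3 ^ (n + 3) + 584 * n - 27) / 32 ∧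
      ∃ q : ℤ, (step M)^[t] (Cf (4 * n + r) 2 p) = Cf r ((3 ^ (n + 2) - 5) / 2) q := by
  obtain ⟨t, k, ht, hk, h⟩ := Cf_iterate n r p
  refine ⟨t, by omega, p, ?_⟩
  rw [← hk, show (2 * k + 5 - 5) / 2 = k by omega]
  exact h
end
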